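/- Let p ∈ (1,∞), q ∈ [1,∞] with conjugate exponent q*, and λ > 0. Then for every β ∈ ℝ^n, the infimum over z ∈ ℝ^m of the quantity max{‖z + Δβ‖_p : Δ ∈ ℝ^{m×n}, ‖Δ‖_{F_q} ≤ λ} − ‖z‖_p − (λ/δ_m(q,p))·‖β‖_{q*} equals 0. -/

import Mathlib

open scoped ENNReal

noncomputable def lpNorm (p : ℝ≥0∞) {ι : Type*} [Fintype ι] (x : ι → ℝ) : ℝ :=
  ‖(WithLp.equiv p (ι → ℝ)).symm x‖

noncomputable def frobNorm (p : ℝ≥0∞) {m n : ℕ} (A : Matrix (Fin m) (Fin n) ℝ) : ℝ :=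
  lpNorm p (fun ij : Fin m × Fin n => A ij.1 ij.2)

noncomputable def discrep (m : ℕ) (a b : ℝ≥0∞) : ℝ :=
  sSup {t : ℝ | ∃ u : Fin m → ℝ, lpNorm b u = 1 ∧ t = lpNorm a u}

section LpNorm

variable {ι κ : Type*} [Fintype ι] [Fintype κ]

theorem lpNorm_top (x : ι → ℝ) : lpNorm ⊤ x = ‖x‖ :=
  (PiLp.norm_ofLp (WithLp.toLp ⊤ x)).symm

theorem lpNorm_eq_sum {p : ℝ≥0∞} (hp : 0 < p.toReal) (x : ι → ℝ) :
    lpNorm p x = (∑ i, |x i| ^ p.toReal) ^ (1 / p.toReal) :=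
  PiLp.norm_eq_sum hp (WithLp.toLp p x)

theorem lpNorm_one (x : ι → ℝ) : lpNorm 1 x = ∑ i, |x i| := by
  rw [lpNorm_eq_sum (by simp)]
  simp

section Fact

variable {p : ℝ≥0∞} [Fact (1 ≤ p)]

theorem toReal_pos_of_one_le (hp : p ≠ ⊤) : 0 < p.toReal :=
  ENNReal.toReal_pos (zero_lt_one.trans_le Fact.out).ne' hp

theorem lpNorm_nonneg (x : ι → ℝ) : 0 ≤ lpNorm p x :=
  norm_nonneg (WithLp.toLp p x)

theorem lpNorm_zero : lpNorm p (0 : ι → ℝ) = 0 :=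
  norm_zero (E := PiLp p fun _ : ι => ℝ)

theorem lpNorm_eq_zero {x : ι → ℝ} : lpNorm p x = 0 ↔ x = 0 :=
  (norm_eq_zero (a := WithLp.toLp p x)).trans (WithLp.toLp_eq_zero p)

theorem lpNorm_add_le (x y : ι → ℝ) : lpNorm p (x + y) ≤ lpNorm p x + lpNorm p y :=
  norm_add_le (WithLp.toLp p x) (WithLp.toLp p y)

theorem lpNorm_smul (c : ℝ) (x : ι → ℝ) : lpNorm p (c • x) = |c| * lpNorm p x :=
  norm_smul c (WithLp.toLp p x)

theorem continuous_lpNorm : Continuous (lpNorm p : (ι → ℝ) → ℝ) :=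
  (PiLp.continuous_toLp p _).norm

theorem norm_le_lpNorm (x : ι → ℝ) : ‖x‖ ≤ lpNorm p x :=
  (pi_norm_le_iff_of_nonneg (lpNorm_nonneg x)).2 fun i => PiLp.norm_apply_le (WithLp.toLp p x) i

theorem lpNorm_mono {x y : ι → ℝ} (h : ∀ i, |x i| ≤ |y i|) : lpNorm p x ≤ lpNorm p y := by
  by_cases hp : p = ⊤
  · subst hp
    rw [lpNorm_top, lpNorm_top]
    exact (pi_norm_le_iff_of_nonneg (norm_nonneg y)).2 fun i => (h i).trans (norm_le_pi_norm y i)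
  · have hp0 := toReal_pos_of_one_le hp
    rw [lpNorm_eq_sum hp0, lpNorm_eq_sum hp0]
    refine Real.rpow_le_rpow (by positivity) (Finset.sum_le_sum fun i _ => ?_) (by positivity)
    exact Real.rpow_le_rpow (abs_nonneg _) (h i) hp0.le

theorem lpNorm_abs (x : ι → ℝ) : lpNorm p (fun i => |x i|) = lpNorm p x :=
  le_antisymm (lpNorm_mono fun i => by simp) (lpNorm_mono fun i => by simp)

theorem lpNorm_lpNorm_rows (A : ι → κ → ℝ) :
    lpNorm p (fun i => lpNorm p (A i)) = lpNorm p (fun ij : ι × κ => A ij.1 ij.2) := by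
  by_cases hp : p = ⊤
  · subst hp
    simp only [lpNorm_top]
    apply le_antisymm
    · refine (pi_norm_le_iff_of_nonneg (norm_nonneg _)).2 fun i => ?_
      rw [norm_norm]
      exact (pi_norm_le_iff_of_nonneg (norm_nonneg _)).2 fun j =>
        norm_le_pi_norm (fun ij : ι × κ => A ij.1 ij.2) (i, j)
    · refine (pi_norm_le_iff_of_nonneg (norm_nonneg _)).2 fun ij => ?_
      refine (norm_le_pi_norm (A ij.1) ij.2).trans ?_
      simpa using norm_le_pi_norm (fun i => ‖A i‖) ij.1
  · have hp0 := toReal_pos_of_one_le hp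
    rw [lpNorm_eq_sum hp0, lpNorm_eq_sum hp0, Fintype.sum_prod_type]
    congr 1
    refine Finset.sum_congr rfl fun i _ => ?_
    rw [abs_of_nonneg (lpNorm_nonneg _), lpNorm_eq_sum hp0, ← Real.rpow_mul (by positivity),
      one_div_mul_cancel hp0.ne', Real.rpow_one]

theorem exists_lpNorm_eq_one [Nonempty ι] : ∃ u : ι → ℝ, lpNorm p u = 1 := by
  obtain ⟨x, hx⟩ := exists_norm_eq (PiLp p fun _ : ι => ℝ) zero_le_one
  exact ⟨WithLp.ofLp x, hx⟩

theorem isCompact_lpNorm_eq_one : IsCompact {u : ι → ℝ | lpNorm p u = 1} := by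
  refine Metric.isCompact_of_isClosed_isBounded
    (isClosed_eq continuous_lpNorm continuous_const) ?_
  refine (Metric.isBounded_closedBall (x := (0 : ι → ℝ)) (r := 1)).subset fun u hu => ?_
  rw [mem_closedBall_zero_iff]
  exact (norm_le_lpNorm u).trans (Set.mem_ofPred.1 hu).le

end Fact

theorem differentiableAt_lpNorm {p : ℝ≥0∞} (hp1 : 1 < p) (hp : p ≠ ⊤) {u : ι → ℝ} (hu : u ≠ 0) :
    DifferentiableAt ℝ (lpNorm p) u := by
  have hp1' : 1 < p.toReal := by
    simpa using (ENNReal.toReal_lt_toReal ENNReal.one_ne_top hp).2 hp1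
  have hp0 := zero_lt_one.trans hp1'
  have hsum : 0 < ∑ i, |u i| ^ p.toReal := by
    obtain ⟨i, hi⟩ := Function.ne_iff.1 hu
    exact Finset.sum_pos' (fun _ _ => by positivity)
      ⟨i, Finset.mem_univ i, Real.rpow_pos_of_pos (abs_pos.2 hi) _⟩
  have hd : DifferentiableAt ℝ (fun x : ι → ℝ => ∑ i, |x i| ^ p.toReal) u := by
    refine DifferentiableAt.fun_sum fun i _ => ?_
    exact DifferentiableAt.comp u (g := fun t : ℝ => |t| ^ p.toReal)
      (hasDerivAt_abs_rpow (u i) hp1').differentiableAt (differentiableAt_apply i u)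
  rw [funext (lpNorm_eq_sum (ι := ι) hp0)]
  exact hd.rpow_const (Or.inl hsum.ne')

theorem abs_sum_mul_le_lpNorm_mul_lpNorm {q r : ℝ≥0∞} [hqr : q.HolderConjugate r] (x y : ι → ℝ) :
    |∑ i, x i * y i| ≤ lpNorm q x * lpNorm r y := by
  have one_top : ∀ x y : ι → ℝ, ∑ i, |x i| * |y i| ≤ lpNorm 1 x * lpNorm ⊤ y := fun x y => by
    rw [lpNorm_one, lpNorm_top, Finset.sum_mul]
    gcongr
    exact norm_le_pi_norm y _
  refine (Finset.abs_sum_le_sum_abs _ _).trans ?_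
  simp only [abs_mul]
  by_cases hq : q = ⊤
  · subst hq
    obtain rfl : r = 1 := ENNReal.HolderConjugate.unique ⊤ r 1
    simpa only [mul_comm] using one_top y x
  by_cases hr : r = ⊤
  · subst hr
    have := hqr.symm
    obtain rfl : q = 1 := ENNReal.HolderConjugate.unique ⊤ q 1
    exact one_top x y
  have h := ENNReal.HolderConjugate.toReal_of_ne_top hq hr
  rw [lpNorm_eq_sum h.pos, lpNorm_eq_sum h.symm.pos]
  simpa using Real.inner_le_Lp_mul_Lq Finset.univ (fun i => |x i|) (fun i => |y i|) h

theorem exists_sum_mul_eq_lpNorm {q r : ℝ≥0∞} [hqr : q.HolderConjugate r] (y : ι → ℝ) :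
    ∃ x : ι → ℝ, lpNorm q x ≤ 1 ∧ ∑ i, x i * y i = lpNorm r y := by
  classical
  by_cases hq : q = ⊤
  · subst hq
    obtain rfl : r = 1 := ENNReal.HolderConjugate.unique ⊤ r 1
    refine ⟨fun i => SignType.sign (y i), ?_, ?_⟩
    · rw [lpNorm_top, pi_norm_le_iff_of_nonneg zero_le_one]
      intro i
      rcases lt_trichotomy (y i) 0 with h | h | h <;> simp [h]
    · simp [lpNorm_one, sign_mul_self]
  by_cases hr : r = ⊤
  · subst hr
    have := hqr.symm
    obtain rfl : q = 1 := ENNReal.HolderConjugate.unique ⊤ q 1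
    rcases isEmpty_or_nonempty ι with hι | hι
    · exact ⟨0, by simp [lpNorm_one], by simp [lpNorm_top, Subsingleton.elim y 0]⟩
    obtain ⟨j, hj⟩ := Finite.exists_max fun i => ‖y i‖
    have hy : ‖y‖ = |y j| :=
      le_antisymm ((pi_norm_le_iff_of_nonneg (norm_nonneg _)).2 hj) (norm_le_pi_norm y j)
    refine ⟨Pi.single j (SignType.sign (y j) : ℝ), ?_, ?_⟩
    · rw [lpNorm_one, Finset.sum_eq_single j (fun i _ hi => by simp [hi]) (by simp)]
      rcases lt_trichotomy (y j) 0 with h | h | h <;> simp [h]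
    · rw [lpNorm_top, hy, Finset.sum_eq_single j (fun i _ hi => by simp [hi]) (by simp)]
      simp [sign_mul_self]
  have h := ENNReal.HolderConjugate.toReal_of_ne_top hq hr
  obtain ⟨g, hg, hgy⟩ := (NNReal.isGreatest_Lp Finset.univ (fun i => ‖y i‖₊) h.symm).1
  refine ⟨fun i => SignType.sign (y i) * (g i : ℝ), ?_, ?_⟩
  · rw [lpNorm_eq_sum h.pos]
    refine Real.rpow_le_one (by positivity) ?_ (one_div_nonneg.2 h.nonneg)
    have hg' : ∑ i, (g i : ℝ) ^ q.toReal ≤ 1 := by exact_mod_cast Set.mem_ofPred.1 hg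
    refine le_trans (Finset.sum_le_sum fun i _ => ?_) hg'
    refine Real.rpow_le_rpow (abs_nonneg _) ?_ h.nonneg
    rw [abs_mul, abs_of_nonneg (g i).coe_nonneg]
    refine mul_le_of_le_one_left (g i).2 ?_
    rcases lt_trichotomy (y i) 0 with h | h | h <;> simp [h]
  · rw [lpNorm_eq_sum h.symm.pos]
    have := congrArg ((↑) : NNReal → ℝ) hgy
    push_cast at this
    simp only [Real.norm_eq_abs] at this
    rw [← this]
    refine Finset.sum_congr rfl fun i _ => ?_
    rw [← sign_mul_self (y i)]
    ring

end LpNorm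

section Frob

variable {m n : ℕ} {q r : ℝ≥0∞}

theorem lpNorm_mulVec_le [Fact (1 ≤ q)] [q.HolderConjugate r] (A : Matrix (Fin m) (Fin n) ℝ)
    (b : Fin n → ℝ) : lpNorm q (A.mulVec b) ≤ frobNorm q A * lpNorm r b := by
  have : Fact (1 ≤ r) := ⟨ENNReal.HolderConjugate.one_le r q⟩
  have hrows := lpNorm_lpNorm_rows (p := q) A
  calc lpNorm q (A.mulVec b) ≤ lpNorm q (lpNorm r b • fun i => lpNorm q (A i)) := by
        refine lpNorm_mono fun i => (abs_sum_mul_le_lpNorm_mul_lpNorm (q := q) (r := r) (A i) b).trans ?_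
        rw [mul_comm]
        exact le_abs_self _
    _ = frobNorm q A * lpNorm r b := by
        rw [lpNorm_smul, abs_of_nonneg (lpNorm_nonneg b), hrows, mul_comm, frobNorm]

theorem frobNorm_vecMulVec [Fact (1 ≤ q)] (v : Fin m → ℝ) (x : Fin n → ℝ) :
    frobNorm q (Matrix.vecMulVec v x) = lpNorm q v * lpNorm q x := by
  have hrows := lpNorm_lpNorm_rows (p := q) (fun i j => v i * x j)
  have hrow : ∀ i, lpNorm q (fun j => v i * x j) = |v i| * lpNorm q x := fun i =>
    lpNorm_smul (v i) x
  have hsmul := lpNorm_smul (p := q) (lpNorm q x) (fun i => |v i|)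
  rw [lpNorm_abs, abs_of_nonneg (lpNorm_nonneg x)] at hsmul
  rw [mul_comm, ← hsmul]
  refine hrows.symm.trans ?_
  simp only [hrow]
  exact congrArg (lpNorm q) (funext fun i => mul_comm _ _)

theorem exists_frobNorm_le_mulVec_eq [Fact (1 ≤ q)] [q.HolderConjugate r] {c : ℝ}
    {b : Fin n → ℝ} (hc : 0 ≤ c) {v : Fin m → ℝ} (hv : lpNorm q v ≤ c * lpNorm r b) :
    ∃ A : Matrix (Fin m) (Fin n) ℝ, frobNorm q A ≤ c ∧ A.mulVec b = v := by
  have : Fact (1 ≤ r) := ⟨ENNReal.HolderConjugate.one_le r q⟩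
  obtain ⟨x, hx, hxb⟩ := exists_sum_mul_eq_lpNorm (q := q) (r := r) b
  rcases (lpNorm_nonneg (p := r) b).eq_or_lt with hb | hb
  · have hv0 : v = 0 := by
      rw [← lpNorm_eq_zero (p := q)]
      exact le_antisymm (by simpa [← hb] using hv) (lpNorm_nonneg v)
    exact ⟨0, (lpNorm_zero (p := q)).trans_le hc, by simp [hv0]⟩
  · refine ⟨Matrix.vecMulVec ((lpNorm r b)⁻¹ • v) x, ?_, ?_⟩
    · rw [frobNorm_vecMulVec, lpNorm_smul, abs_of_pos (inv_pos.2 hb)]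
      have h : (lpNorm r b)⁻¹ * lpNorm q v ≤ c := by
        rw [inv_mul_le_iff₀ hb, mul_comm]
        exact hv
      exact (mul_le_mul h hx (lpNorm_nonneg x) hc).trans_eq (mul_one c)
    · ext i
      have : ∑ j, (lpNorm r b)⁻¹ * v i * x j * b j = v i := by
        simp_rw [mul_assoc _ (x _) (b _)]
        rw [← Finset.mul_sum, hxb]
        field_simp
      simpa [Matrix.mulVec, dotProduct, Matrix.vecMulVec_apply] using this

end Frob

section Discrep

variable {m : ℕ} {p q : ℝ≥0∞} [Fact (1 ≤ p)] [Fact (1 ≤ q)]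

theorem exists_lpNorm_eq_discrep [NeZero m] :
    ∃ u : Fin m → ℝ, lpNorm p u = 1 ∧ lpNorm q u = discrep m q p ∧
      ∀ x : Fin m → ℝ, lpNorm q x ≤ discrep m q p * lpNorm p x := by
  obtain ⟨u, hu, hmax⟩ := (isCompact_lpNorm_eq_one (ι := Fin m) (p := p)).exists_isMaxOn
    exists_lpNorm_eq_one (continuous_lpNorm (p := q)).continuousOn
  have hd : lpNorm q u = discrep m q p := by
    have hgreat : IsGreatest {t : ℝ | ∃ w : Fin m → ℝ, lpNorm p w = 1 ∧ t = lpNorm q w}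
        (lpNorm q u) := by
      refine ⟨⟨u, hu, rfl⟩, ?_⟩
      rintro _ ⟨w, hw, rfl⟩
      exact hmax hw
    exact hgreat.csSup_eq.symm
  refine ⟨u, hu, hd, fun x => ?_⟩
  rcases (lpNorm_nonneg (p := p) x).eq_or_lt with hx | hx
  · rw [lpNorm_eq_zero.1 hx.symm, lpNorm_zero, lpNorm_zero, mul_zero]
  · have h1 : lpNorm p ((lpNorm p x)⁻¹ • x) = 1 := by
      rw [lpNorm_smul, abs_of_pos (inv_pos.2 hx), inv_mul_cancel₀ hx.ne']
    have h2 : lpNorm q ((lpNorm p x)⁻¹ • x) ≤ lpNorm q u := hmax h1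
    rwa [lpNorm_smul, abs_of_pos (inv_pos.2 hx), hd, inv_mul_le_iff₀ hx, mul_comm] at h2

theorem discrep_pos [NeZero m] : 0 < discrep m q p := by
  obtain ⟨u, hu, hd, -⟩ := exists_lpNorm_eq_discrep (m := m) (p := p) (q := q)
  rw [← hd]
  refine (lpNorm_nonneg u).lt_of_ne' fun h => ?_
  rw [lpNorm_eq_zero.1 h, lpNorm_zero] at hu
  exact zero_ne_one hu

theorem exists_le_lpNorm_add [NeZero m] {ρ : ℝ} (hρ : 0 ≤ ρ) (z : Fin m → ℝ) :
    ∃ v : Fin m → ℝ, lpNorm q v ≤ ρ ∧ lpNorm p z + ρ / discrep m q p ≤ lpNorm p (z + v) := by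
  obtain ⟨u, hu, hd, hle⟩ := exists_lpNorm_eq_discrep (m := m) (p := p) (q := q)
  have hpos := discrep_pos (m := m) (p := p) (q := q)
  -- A direction `w` along which `z` is a nonnegative multiple.
  obtain ⟨w, hw, s, hs, hz⟩ : ∃ w : Fin m → ℝ, lpNorm q w ≠ 0 ∧ ∃ s : ℝ, 0 ≤ s ∧ z = s • w := by
    by_cases hz : z = 0
    · exact ⟨u, hd ▸ hpos.ne', 0, le_rfl, by simp [hz]⟩
    · exact ⟨z, mt lpNorm_eq_zero.1 hz, 1, zero_le_one, by simp⟩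
  have hw : 0 < lpNorm q w := (lpNorm_nonneg w).lt_of_ne' hw
  refine ⟨(ρ / lpNorm q w) • w, ?_, ?_⟩
  · rw [lpNorm_smul, abs_of_nonneg (by positivity), div_mul_cancel₀ _ hw.ne']
  · rw [hz, ← add_smul, lpNorm_smul, lpNorm_smul, abs_of_nonneg hs, abs_of_nonneg (by positivity),
      add_mul]
    gcongr
    rw [div_le_iff₀ hpos, div_mul_eq_mul_div, div_mul_eq_mul_div, le_div_iff₀ hw]
    nlinarith [mul_le_mul_of_nonneg_left (hle w) hρ]

theorem fderiv_lpNorm_le [NeZero m] (hp1 : 1 < p) (hp : p ≠ ⊤) {u : Fin m → ℝ}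
    (hu : lpNorm p u = 1) (hd : lpNorm q u = discrep m q p)
    (hle : ∀ x : Fin m → ℝ, lpNorm q x ≤ discrep m q p * lpNorm p x) (v : Fin m → ℝ) :
    fderiv ℝ (lpNorm p) u v ≤ lpNorm q v / discrep m q p := by
  have hpos := discrep_pos (m := m) (p := p) (q := q)
  have hu0 : u ≠ 0 := by
    rintro rfl
    rw [lpNorm_zero] at hu
    exact zero_ne_one hu
  have hderiv : HasDerivAt (fun s : ℝ => lpNorm p (u + s • v)) (fderiv ℝ (lpNorm p) u v) 0 := by
    have h := (differentiableAt_lpNorm hp1 hp hu0).hasFDerivAt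
    exact h.hasLineDerivAt v
  have hslope := hderiv.tendsto_slope_zero_left
  refine le_of_tendsto hslope ?_
  filter_upwards [self_mem_nhdsWithin] with s hs
  have hs : s < 0 := hs
  have h1 : discrep m q p - |s| * lpNorm q v ≤ lpNorm q (u + s • v) := by
    have := lpNorm_add_le (p := q) (u + s • v) (-s • v)
    rw [neg_smul, add_neg_cancel_right, hd, ← neg_smul, lpNorm_smul, abs_neg] at this
    linarith
  have h2 := h1.trans (hle _)
  rw [abs_of_neg hs] at h2
  simp only [zero_add, zero_smul, add_zero, hu, smul_eq_mul]
  rw [inv_mul_eq_div, div_le_iff_of_neg hs, div_mul_eq_mul_div, div_le_iff₀ hpos]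
  nlinarith

theorem exists_forall_lpNorm_add_le [NeZero m] (hp1 : 1 < p) (hp : p ≠ ⊤) (ρ : ℝ) {ε : ℝ}
    (hε : 0 < ε) : ∃ z : Fin m → ℝ, ∀ v : Fin m → ℝ, lpNorm q v ≤ ρ →
      lpNorm p (z + v) ≤ lpNorm p z + ρ / discrep m q p + ε := by
  obtain ⟨u, hu, hd, hle⟩ := exists_lpNorm_eq_discrep (m := m) (p := p) (q := q)
  have hpos := discrep_pos (m := m) (p := p) (q := q)
  have hu0 : u ≠ 0 := by
    rintro rfl
    rw [lpNorm_zero] at hu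
    exact zero_ne_one hu
  have h := (differentiableAt_lpNorm hp1 hp hu0).hasFDerivAt
  have hc : 0 < |ρ| + 1 := by positivity
  have ho := (hasFDerivAt_iff_isLittleO_nhds_zero.1 h).def (div_pos hε hc)
  obtain ⟨r, hr, hball⟩ := Metric.eventually_nhds_iff.1 ho
  set s := r / (|ρ| + 1) with hs_def
  have hs : 0 < s := div_pos hr hc
  refine ⟨s⁻¹ • u, fun v hv => ?_⟩
  have hvn : ‖v‖ < |ρ| + 1 := by
    have := norm_le_lpNorm (p := q) v
    have := le_abs_self ρ
    linarith
  have hsv : ‖s • v‖ = s * ‖v‖ := by rw [norm_smul, Real.norm_of_nonneg hs.le]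
  have hsmall : dist (s • v) 0 < r := by
    rw [dist_zero_right, hsv, hs_def, div_mul_eq_mul_div, div_lt_iff₀ hc]
    exact mul_lt_mul_of_pos_left hvn hr
  have hest := (le_abs_self _).trans (hball hsmall)
  have hL : fderiv ℝ (lpNorm p) u v ≤ ρ / discrep m q p :=
    (fderiv_lpNorm_le hp1 hp hu hd hle v).trans (by gcongr)
  have hεv : ε / (|ρ| + 1) * ‖v‖ ≤ ε := by
    rw [div_mul_eq_mul_div, div_le_iff₀ hc]
    gcongr
  have hz : s⁻¹ • u + v = s⁻¹ • (u + s • v) := by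
    rw [smul_add, inv_smul_smul₀ hs.ne']
  rw [hz, lpNorm_smul, lpNorm_smul, abs_of_pos (inv_pos.2 hs), inv_mul_le_iff₀ hs, hu]
  rw [map_smul, smul_eq_mul, hsv, hu] at hest
  have h1 : s * (s⁻¹ * 1 + ρ / discrep m q p + ε) = 1 + s * (ρ / discrep m q p + ε) := by
    field_simp
    ring
  rw [h1]
  nlinarith [mul_le_mul_of_nonneg_left (add_le_add hL hεv) hs.le]

end Discrep

/-- The regularization lower bound is tight: its gap has infimum 0 over z. -/
theorem stmt13 {m n : ℕ} (p q qs : ℝ≥0∞) (hp1 : 1 < p) (hp2 : p ≠ ⊤) (hq : 1 ≤ q)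
    (hqs : 1 / q + 1 / qs = 1) (lam : ℝ) (hlam : 0 < lam) (β : Fin n → ℝ) :
    sInf {d : ℝ | ∃ z : Fin m → ℝ,
        d = sSup {t : ℝ | ∃ Δ : Matrix (Fin m) (Fin n) ℝ, frobNorm q Δ ≤ lam ∧
              t = lpNorm p (z + Δ.mulVec β)}
            - lpNorm p z - lam / discrep m q p * lpNorm qs β} = 0 := by
  have : Fact (1 ≤ p) := ⟨hp1.le⟩
  have : Fact (1 ≤ q) := ⟨hq⟩
  have hconj : q.HolderConjugate qs := ENNReal.holderConjugate_iff.2 (by simpa using hqs)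
  have : Fact (1 ≤ qs) := ⟨ENNReal.HolderConjugate.one_le qs q⟩
  have hset : ∀ z : Fin m → ℝ,
      {t : ℝ | ∃ Δ : Matrix (Fin m) (Fin n) ℝ, frobNorm q Δ ≤ lam ∧
        t = lpNorm p (z + Δ.mulVec β)} =
      (fun v => lpNorm p (z + v)) '' {v | lpNorm q v ≤ lam * lpNorm qs β} := by
    intro z
    ext t
    constructor
    · rintro ⟨Δ, hΔ, rfl⟩
      exact ⟨Δ.mulVec β, (lpNorm_mulVec_le Δ β).trans
        (mul_le_mul_of_nonneg_right hΔ (lpNorm_nonneg β)), rfl⟩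
    · rintro ⟨v, hv, rfl⟩
      obtain ⟨Δ, hΔ, rfl⟩ := exists_frobNorm_le_mulVec_eq hlam.le hv
      exact ⟨Δ, hΔ, rfl⟩
  have hρ : 0 ≤ lam * lpNorm qs β := mul_nonneg hlam.le (lpNorm_nonneg β)
  simp only [hset, div_mul_eq_mul_div]
  generalize lam * lpNorm qs β = ρ at hρ
  have hne : ∀ z : Fin m → ℝ, ((fun v => lpNorm p (z + v)) '' {v | lpNorm q v ≤ ρ}).Nonempty :=
    fun z => ⟨_, 0, (lpNorm_zero (p := q)).trans_le hρ, rfl⟩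
  rcases Nat.eq_zero_or_pos m with rfl | hm
  · have hzero : ∀ v : Fin 0 → ℝ, lpNorm p v = 0 := fun v =>
      lpNorm_eq_zero.2 (Subsingleton.elim v 0)
    have hdis : discrep 0 q p = 0 := by simp [discrep, hzero]
    simp only [hzero] at hne ⊢
    simp [hdis, (Set.image_nonempty.1 (hne 0)).image_const]
  have : NeZero m := ⟨hm.ne'⟩
  have hbdd : ∀ z : Fin m → ℝ, BddAbove ((fun v => lpNorm p (z + v)) '' {v | lpNorm q v ≤ ρ}) := by
    rintro z
    refine ⟨lpNorm p z + discrep m p q * ρ, ?_⟩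
    rintro _ ⟨v, hv, rfl⟩
    obtain ⟨-, -, -, hle⟩ := exists_lpNorm_eq_discrep (m := m) (p := q) (q := p)
    refine (lpNorm_add_le z v).trans (add_le_add_right ((hle v).trans ?_) _)
    exact mul_le_mul_of_nonneg_left hv discrep_pos.le
  refine csInf_eq_of_forall_ge_of_forall_gt_exists_lt ⟨_, 0, rfl⟩ ?_ ?_
  · rintro _ ⟨z, rfl⟩
    obtain ⟨v, hv, hzv⟩ := exists_le_lpNorm_add (p := p) (q := q) hρ z
    have := le_csSup (hbdd z) ⟨v, hv, rfl⟩
    dsimp only at this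
    linarith
  · intro ε hε
    obtain ⟨z, hz⟩ := exists_forall_lpNorm_add_le (m := m) (q := q) hp1 hp2 ρ (half_pos hε)
    refine ⟨_, ⟨z, rfl⟩, ?_⟩
    have := csSup_le (hne z) (Set.forall_mem_image.2 fun v hv => hz v hv)
    linarith
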